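/- arXiv:1707.04366 — 2 statements merged into one kernel-verified Lean document; each statement's English description precedes it below -/
import Mathlib

section
/- Let (R, m) be a Noetherian local ring of dimension d and let f_1, ..., f_c be part of a system of parameters (i.e., dim R/(f_1,...,f_c) = d - c). Then there exists an integer N > 0 such that for all ε_1, ..., ε_c ∈ m^N, the elements f_1 + ε_1, ..., f_c + ε_c are also part of a system of parameters, i.e., dim R/(f_1 + ε_1, ..., f_c + ε_c) = d - c. -/
open IsLocalRing

namespace IsLocalRing

variable {R : Type*} [CommRing R] [IsLocalRing R]

theorem map_quotientMk_maximalIdeal {J : Ideal R} [IsLocalRing (R ⧸ J)] :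
    (maximalIdeal R).map (Ideal.Quotient.mk J) = maximalIdeal (R ⧸ J) := by
  have := IsLocalHom.of_surjective (Ideal.Quotient.mk J) Ideal.Quotient.mk_surjective
  have hcomap : (maximalIdeal (R ⧸ J)).comap (Ideal.Quotient.mk J) = maximalIdeal R :=
    ((local_hom_TFAE (Ideal.Quotient.mk J)).out 0 4 rfl rfl).mp this
  rw [← hcomap, Ideal.map_comap_of_surjective _ Ideal.Quotient.mk_surjective]

variable [IsNoetherianRing R]

/-- The Krull dimension of a Noetherian local ring is at most `n` if and only if some `n` or fewer
elements generate an ideal primary to the maximal ideal. -/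
theorem ringKrullDim_le_natCast_iff_exists_finset {n : ℕ} :
    ringKrullDim R ≤ n ↔ ∃ s : Finset R, s.card ≤ n ∧ Ideal.span (s : Set R) ≤ maximalIdeal R ∧
      ∃ k, maximalIdeal R ^ k ≤ Ideal.span (s : Set R) := by
  rw [← maximalIdeal_height_eq_ringKrullDim]
  constructor
  · intro h
    obtain ⟨s, hs, hcard⟩ := (maximalIdeal R).exists_finset_card_eq_height_of_isNoetherianRing
    refine ⟨s, ?_, hs.1.2, ?_⟩
    · rw [← hcard] at h
      exact_mod_cast h
    · refine Ideal.exists_pow_le_of_le_radical_of_fg ?_ (IsNoetherian.noetherian _)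
      rw [Ideal.radical_eq_sInf]
      refine le_sInf fun p ⟨hp, hprime⟩ ↦ ?_
      exact hs.2 ⟨hprime, hp⟩ (le_maximalIdeal hprime.ne_top)
  · rintro ⟨s, hcard, hs, k, hk⟩
    have hmin : maximalIdeal R ∈ (Ideal.span (s : Set R)).minimalPrimes :=
      ⟨⟨inferInstance, hs⟩, fun p ⟨hprime, hp⟩ _ ↦ hprime.le_of_pow_le (hk.trans hp)⟩
    have := Ideal.height_le_card_of_mem_minimalPrimes_span_finset hmin
    exact_mod_cast this.trans (by exact_mod_cast hcard)

/-- Relative form of `ringKrullDim_le_natCast_iff_exists_finset` for a quotient ring. -/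
theorem ringKrullDim_quotient_le_natCast_iff_exists_finset {J : Ideal R}
    (hJ : J ≤ maximalIdeal R) {n : ℕ} :
    ringKrullDim (R ⧸ J) ≤ n ↔
      ∃ t : Finset R, t.card ≤ n ∧ Ideal.span (t : Set R) ≤ maximalIdeal R ∧
        ∃ k, maximalIdeal R ^ k ≤ Ideal.span (t : Set R) ⊔ J := by
  classical
  have : Nontrivial (R ⧸ J) := Ideal.Quotient.nontrivial_iff.mpr
    (hJ.trans_lt (lt_top_iff_ne_top.mpr Ideal.IsPrime.ne_top')).ne
  have : IsLocalRing (R ⧸ J) := .of_surjective' _ Ideal.Quotient.mk_surjective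
  rw [ringKrullDim_le_natCast_iff_exists_finset, ← map_quotientMk_maximalIdeal]
  constructor
  · rintro ⟨s, hcard, hs, k, hk⟩
    have hlift : Ideal.span (s : Set (R ⧸ J)) =
        (Ideal.span ((s.image (Function.surjInv Ideal.Quotient.mk_surjective) : Finset R) :
          Set R)).map (Ideal.Quotient.mk J) := by
      rw [Ideal.map_span, Finset.coe_image, ← Set.image_comp,
        (Function.rightInverse_surjInv _).comp_eq_id, Set.image_id]
    rw [hlift] at hs hk
    refine ⟨s.image (Function.surjInv Ideal.Quotient.mk_surjective),
      Finset.card_image_le.trans hcard, ?_, k, ?_⟩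
    · rw [Ideal.map_le_iff_le_comap, Ideal.comap_map_quotientMk, sup_eq_right.mpr hJ] at hs
      exact hs
    · rwa [← Ideal.map_pow, Ideal.map_le_iff_le_comap, Ideal.comap_map_quotientMk, sup_comm] at hk
  · rintro ⟨t, hcard, ht, k, hk⟩
    refine ⟨t.image (Ideal.Quotient.mk J), Finset.card_image_le.trans hcard, ?_, k, ?_⟩
    · rw [Finset.coe_image, ← Ideal.map_span]
      exact Ideal.map_mono ht
    · rwa [Finset.coe_image, ← Ideal.map_span, ← Ideal.map_pow, Ideal.map_le_iff_le_comap,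
        Ideal.comap_map_quotientMk, sup_comm]

end IsLocalRing

theorem Ideal.span_range_le_span_range_add_sup {R ι : Type*} [CommRing R] {I : Ideal R}
    (f : ι → R) {ε : ι → R} (hε : ∀ i, ε i ∈ I) :
    span (Set.range f) ≤ span (Set.range fun i ↦ f i + ε i) ⊔ I := by
  rw [span_le]
  rintro _ ⟨i, rfl⟩
  rw [SetLike.mem_coe, ← add_sub_cancel_right (f i) (ε i)]
  exact sub_mem (mem_sup_left (subset_span ⟨i, rfl⟩)) (mem_sup_right (hε i))

theorem stmt_2 {R : Type*} [CommRing R] [IsNoetherianRing R] [IsLocalRing R]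
    (d c : ℕ) (hcd : c ≤ d) (hdimR : ringKrullDim R = (d : ℕ))
    (f : Fin c → R) (hf : ∀ i, f i ∈ maximalIdeal R)
    (hsop : ringKrullDim (R ⧸ Ideal.span (Set.range f)) = ((d - c : ℕ) : WithBot ℕ∞)) :
    ∃ N : ℕ, 0 < N ∧ ∀ ε : Fin c → R, (∀ i, ε i ∈ (maximalIdeal R) ^ N) →
      ringKrullDim (R ⧸ Ideal.span (Set.range fun i => f i + ε i)) =
        ((d - c : ℕ) : WithBot ℕ∞) := by
  classical
  have hspan : Ideal.span (Set.range f) ≤ maximalIdeal R :=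
    Ideal.span_le.mpr (Set.range_subset_iff.mpr hf)
  obtain ⟨t, hcard, ht, k, hk⟩ :=
    (ringKrullDim_quotient_le_natCast_iff_exists_finset hspan).mp hsop.le
  refine ⟨k + 1, k.succ_pos, fun ε hε ↦ ?_⟩
  have hg : ∀ i, f i + ε i ∈ maximalIdeal R :=
    fun i ↦ add_mem (hf i) (Ideal.pow_le_self k.succ_ne_zero (hε i))
  have hspan' : Ideal.span (Set.range fun i ↦ f i + ε i) ≤ maximalIdeal R :=
    Ideal.span_le.mpr (Set.range_subset_iff.mpr hg)
  refine le_antisymm ((ringKrullDim_quotient_le_natCast_iff_exists_finset hspan').mpr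
    ⟨t, hcard, ht, k, ?_⟩) ?_
  · refine Submodule.le_of_le_smul_of_le_jacobson_bot (IsNoetherian.noetherian _)
      (maximalIdeal_le_jacobson _) ?_
    rw [smul_eq_mul, ← pow_succ', sup_assoc]
    exact hk.trans (sup_le_sup_left (Ideal.span_range_le_span_range_add_sup f hε) _)
  · have hle := ringKrullDim_le_ringKrullDim_quotient_add_card
      (Finset.univ.image fun i ↦ f i + ε i) (R := R) (by
        rw [Finset.coe_image, Finset.coe_univ, Set.image_univ]
        exact (Set.range_subset_iff.mpr hg).trans (ringJacobson_eq_maximalIdeal R).ge)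
    rw [Finset.coe_image, Finset.coe_univ, Set.image_univ, hdimR] at hle
    have hcard' : (Finset.univ.image fun i ↦ f i + ε i).card ≤ c := by
      simpa using Finset.card_image_le (s := Finset.univ) (f := fun i ↦ f i + ε i)
    generalize ringKrullDim (R ⧸ Ideal.span (Set.range fun i ↦ f i + ε i)) = x at hle ⊢
    have hle' : (d : WithBot ℕ∞) ≤ x + c := hle.trans (by gcongr)
    induction x with
    | bot => simp at hle'
    | coe x =>
      induction x with
      | top => exact_mod_cast le_top
      | coe x =>
        norm_cast at hle'
        have hsub : d - c ≤ x := by omega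
        generalize d - c = n at hsub ⊢
        exact_mod_cast hsub
end

section
/- Let R be a commutative Noetherian ring of prime characteristic p, x_1, ..., x_d ∈ R, q a power of p, and J an ideal with R/(J + (x_1,...,x_d)) of finite length. Then length(R/(J + (x_1^q, ..., x_d^q))) ≤ q^d · length(R/(J + (x_1, ..., x_d))). -/
theorem Module.length_le_add_of_exact {R N M P : Type*} [Ring R] [AddCommGroup N] [Module R N]
    [AddCommGroup M] [Module R M] [AddCommGroup P] [Module R P]
    (f : N →ₗ[R] M) (g : M →ₗ[R] P) (hg : Function.Surjective g) (h : Function.Exact f g) :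
    Module.length R M ≤ Module.length R N + Module.length R P := by
  have hex : Function.Exact (LinearMap.range f).subtype g := by
    rw [LinearMap.exact_iff] at h ⊢
    rw [h, Submodule.range_subtype]
  rw [Module.length_eq_add_of_exact _ g (Submodule.subtype_injective _) hg hex]
  gcongr
  exact Module.length_le_of_surjective f.rangeRestrict f.surjective_rangeRestrict

theorem Ideal.length_quotient_sup_span_mul_le {R : Type*} [CommRing R] (I : Ideal R) (a b : R) :
    Module.length R (R ⧸ (I ⊔ Ideal.span {a * b})) ≤
      Module.length R (R ⧸ (I ⊔ Ideal.span {b})) +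
        Module.length R (R ⧸ (I ⊔ Ideal.span {a})) := by
  have hle : I ⊔ Ideal.span {a * b} ≤ I ⊔ Ideal.span {a} :=
    sup_le_sup_left (Ideal.span_singleton_le_span_singleton.2 (dvd_mul_right a b)) I
  have hmul : I ⊔ Ideal.span {b} ≤
      Submodule.comap (LinearMap.mulLeft R a) (I ⊔ Ideal.span {a * b}) := by
    refine sup_le (fun y hy => ?_) ?_
    · exact Ideal.mem_sup_left (I.mul_mem_left a hy)
    · rw [Ideal.span_le, Set.singleton_subset_iff]
      exact Ideal.mem_sup_right (Ideal.mem_span_singleton_self _)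
  refine Module.length_le_add_of_exact (Submodule.mapQ _ _ (LinearMap.mulLeft R a) hmul)
    (Submodule.factor hle) (Submodule.factor_surjective hle) fun y => ?_
  obtain ⟨y, rfl⟩ := Submodule.Quotient.mk_surjective _ y
  constructor
  · intro hy
    obtain ⟨i, hi, z, hz, rfl⟩ := Submodule.mem_sup.1 ((Submodule.Quotient.mk_eq_zero _).1 hy)
    obtain ⟨c, rfl⟩ := Ideal.mem_span_singleton.1 hz
    refine ⟨Submodule.Quotient.mk c, (Submodule.Quotient.eq _).2 ?_⟩
    have : LinearMap.mulLeft R a c - (i + a * c) = -i := by simp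
    rw [this]
    exact Ideal.mem_sup_left (I.neg_mem hi)
  · rintro ⟨c, hc⟩
    obtain ⟨c, rfl⟩ := Submodule.Quotient.mk_surjective _ c
    rw [← hc]
    exact (Submodule.Quotient.mk_eq_zero _).2
      (Ideal.mem_sup_right (Ideal.mem_span_singleton.2 (dvd_mul_right a c)))

theorem Ideal.length_quotient_sup_span_pow_le {R : Type*} [CommRing R] (I : Ideal R) (a : R)
    (n : ℕ) :
    Module.length R (R ⧸ (I ⊔ Ideal.span {a ^ n})) ≤
      n * Module.length R (R ⧸ (I ⊔ Ideal.span {a})) := by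
  induction n with
  | zero =>
    rw [pow_zero, Ideal.span_singleton_one, sup_top_eq]
    simp
  | succ n ih =>
    rw [pow_succ', Nat.cast_succ, add_mul, one_mul]
    exact (Ideal.length_quotient_sup_span_mul_le I a (a ^ n)).trans (by gcongr)

theorem Ideal.length_quotient_sup_span_image_pow_le {R ι : Type*} [CommRing R] (x : ι → R)
    (n : ℕ) (s : Finset ι) (J : Ideal R) :
    Module.length R (R ⧸ (J ⊔ Ideal.span ((fun i => x i ^ n) '' (s : Set ι)))) ≤
      (n ^ s.card : ℕ) * Module.length R (R ⧸ (J ⊔ Ideal.span (x '' (s : Set ι)))) := by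
  classical
  induction s using Finset.induction_on generalizing J with
  | empty =>
    rw [Finset.coe_empty, Set.image_empty, Set.image_empty, Finset.card_empty, pow_zero,
      Nat.cast_one, one_mul]
  | insert a s ha ih =>
    rw [Finset.card_insert_of_notMem ha, Finset.coe_insert, Set.image_insert_eq,
      Set.image_insert_eq, Ideal.span_insert, Ideal.span_insert, ← sup_assoc, ← sup_assoc,
      pow_succ, Nat.cast_mul, mul_assoc]
    refine (ih _).trans (mul_le_mul_right ?_ _)
    rw [sup_right_comm J (Ideal.span {x a ^ n}), sup_right_comm J (Ideal.span {x a})]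
    exact Ideal.length_quotient_sup_span_pow_le _ _ _


/-- The length of a module, defined as the Krull dimension of its lattice of submodules. -/
noncomputable def moduleLength (R M : Type*) [Ring R] [AddCommGroup M] [Module R M] :
    WithBot ℕ∞ :=
  Order.krullDim (Submodule R M)

theorem stmt_11 {R : Type*} [CommRing R] [IsNoetherianRing R]
    (p : ℕ) [Fact p.Prime] [CharP R p] (e : ℕ)
    {d : ℕ} (x : Fin d → R) (J : Ideal R)
    (hfl : IsFiniteLength R (R ⧸ (J ⊔ Ideal.span (Set.range x)))) :
    moduleLength R (R ⧸ (J ⊔ Ideal.span (Set.range fun i => x i ^ p ^ e))) ≤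
      (((p ^ e) ^ d : ℕ) : WithBot ℕ∞) *
        moduleLength R (R ⧸ (J ⊔ Ideal.span (Set.range x))) := by
  have h := Ideal.length_quotient_sup_span_image_pow_le x (p ^ e) Finset.univ J
  rw [Finset.coe_univ, Set.image_univ, Set.image_univ, Finset.card_univ, Fintype.card_fin] at h
  simp only [moduleLength, ← Module.coe_length]
  exact_mod_cast h
end
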